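/- For every μ ≥ 1, (Real.Gamma (μ²) / Q̄_μ) · ∫_{x ∈ D_μ} (∑_{i, j, k, l pairwise distinct} Real.sqrt (p(x) i * p(x) j * p(x) k * p(x) l)) · (∏_{a < b} (p(x) a − p(x) b)²) dx = (1 / (μ² (μ² + 1))) · ∑_{k,l,m,n=0}^{μ−1} det of the 4×4 matrix whose (r, c) entry, for r, c ranging over the ordered list (k, l, m, n), is I_{r c}^{(1/2)}; the sum on the left is over all ordered quadruples of pairwise distinct indices in Fin μ. -/

import Mathlib

open scoped BigOperators

/-- The Laguerre polynomial `L_n`. -/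
noncomputable def laguerre (n : ℕ) (x : ℝ) : ℝ :=
  ∑ k ∈ Finset.range (n + 1), (-1) ^ k * (n.choose k : ℝ) * x ^ k / (k.factorial : ℝ)

/-- `I_{kl}^{(β)} = ∫₀^∞ e^{-q} q^β L_k(q) L_l(q) dq`. -/
noncomputable def Ikl (k l : ℕ) (β : ℝ) : ℝ :=
  ∫ q in Set.Ioi (0 : ℝ), Real.exp (-q) * q ^ β * laguerre k q * laguerre l q

/-- `Q̄_μ = μ! ∏_{k=0}^{μ-1} (k!)²`. -/
noncomputable def Qbar (μ : ℕ) : ℝ :=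
  (μ.factorial : ℝ) * ∏ k ∈ Finset.range μ, ((k.factorial : ℝ)) ^ 2

/-- The simplex domain `D_μ`. -/
def Dset (μ : ℕ) : Set (Fin (μ - 1) → ℝ) :=
  {x | (∀ i, 0 < x i) ∧ ∑ i, x i < 1}

/-- Extension of `x` to the probability simplex in `Fin μ → ℝ`. -/
noncomputable def pExt (μ : ℕ) (x : Fin (μ - 1) → ℝ) : Fin μ → ℝ :=
  fun i => if h : (i : ℕ) < μ - 1 then x ⟨i, h⟩ else 1 - ∑ j, x j


open MeasureTheory in
lemma radial_aux (n : ℕ) (f : (Fin (n+1) → ℝ) → ℝ) (d : ℕ)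
    (hf : ∀ s : ℝ, 0 < s → ∀ p, f (s • p) = s ^ d * f p)
    (hint : IntegrableOn (fun q => Real.exp (-∑ i, q i) * f q)
      (Set.univ.pi fun _ => Set.Ioi (0:ℝ))) :
    ∫ q in (Set.univ.pi fun _ => Set.Ioi (0:ℝ)), Real.exp (-∑ i, q i) * f q
      = ((n + d).factorial : ℝ) * ∫ x in Dset (n+1), f (pExt (n+1) x) := by
  have hms : MeasurableSet (Set.univ.pi fun _ : Fin (n+1) => Set.Ioi (0:ℝ)) :=
    MeasurableSet.univ_pi fun _ => measurableSet_Ioi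
  have hmD : MeasurableSet (Dset (n+1)) := by
    have : Dset (n+1) = (⋂ i, {x | 0 < x i}) ∩ {x | ∑ i, x i < 1} := by
      ext x; simp [Dset]
    rw [this]
    refine (MeasurableSet.iInter fun i => measurableSet_lt measurable_const
      (measurable_pi_apply i)).inter (measurableSet_lt (by fun_prop) measurable_const)
  rw [← integral_indicator hms]
  rw [← integrable_indicator_iff hms] at hint
  set g := (Set.univ.pi fun _ : Fin (n+1) => Set.Ioi (0:ℝ)).indicator
    (fun q => Real.exp (-∑ i, q i) * f q) with hg
  let e := MeasurableEquiv.piFinSuccAbove (fun _ : Fin (n+1) => ℝ) (Fin.last n)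
  have he : MeasurePreserving e.symm volume volume :=
    (volume_preserving_piFinSuccAbove (fun _ : Fin (n+1) => ℝ) (Fin.last n)).symm e
  have hsk : MeasurePreserving (fun p : (Fin n → ℝ) × ℝ => (p.1, p.2 - ∑ i, p.1 i))
      (volume.prod volume) (volume.prod volume) := by
    refine (MeasurePreserving.id volume).skew_product
      (g := fun (y : Fin n → ℝ) (s : ℝ) => s - ∑ i, y i) ?_ ?_
    · simp only [Function.uncurry_def]; fun_prop
    · exact Filter.Eventually.of_forall fun y => (measurePreserving_sub_right volume _).map_eq
  have hΦ : MeasurePreserving (fun p : (Fin n → ℝ) × ℝ => e.symm (p.2 - ∑ i, p.1 i, p.1))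
      (volume.prod volume) volume :=
    he.comp (Measure.measurePreserving_swap.comp hsk)
  have hΦe : ∀ (y : Fin n → ℝ) (s : ℝ), e.symm (s - ∑ i, y i, y)
      = Fin.snoc (α := fun _ => ℝ) y (s - ∑ i, y i) := by
    intro y s
    exact Fin.insertNth_last' _ _
  have h1 : ∫ q, g q = ∫ p : (Fin n → ℝ) × ℝ, g (e.symm (p.2 - ∑ i, p.1 i, p.1))
      ∂(volume.prod volume) := by
    rw [← hΦ.map_eq, integral_map hΦ.aemeasurable]
    rw [hΦ.map_eq]; exact hint.aestronglyMeasurable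
  have h2 : Integrable (fun p : (Fin n → ℝ) × ℝ => g (e.symm (p.2 - ∑ i, p.1 i, p.1)))
      (volume.prod volume) := hΦ.integrable_comp_of_integrable hint
  rw [h1, integral_prod_symm _ h2]
  simp only [hΦe]
  set J := ∫ x in Dset (n+1), f (pExt (n+1) x) with hJ
  have hpE : ∀ x : Fin n → ℝ, pExt (n+1) x
      = Fin.snoc (α := fun _ => ℝ) x (1 - ∑ i, x i) := by
    intro x; ext i; rfl
  have h3 : ∀ s : ℝ, ∫ y : Fin n → ℝ, g (Fin.snoc (α := fun _ => ℝ) y (s - ∑ i, y i))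
      = (Set.Ioi (0:ℝ)).indicator (fun s => Real.exp (-s) * s ^ (n + d) * J) s := by
    intro s
    by_cases hs : 0 < s
    · rw [Set.indicator_of_mem (by exact hs)]
      have h4 := Measure.integral_comp_smul (volume : Measure (Fin n → ℝ))
        (fun y => g (Fin.snoc (α := fun _ => ℝ) y (s - ∑ i, y i))) s
      have h5 : ∀ x : Fin n → ℝ,
          g (Fin.snoc (α := fun _ => ℝ) (s • x) (s - ∑ i, (s • x) i))
          = (Real.exp (-s) * s ^ d) * (Dset (n+1)).indicator (fun x => f (pExt (n+1) x)) x := by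
        intro x
        have h6 : (Fin.snoc (α := fun _ => ℝ) (s • x) (s - ∑ i, (s • x) i) : Fin (n+1) → ℝ)
            = s • pExt (n+1) x := by
          rw [hpE]
          ext i
          refine Fin.lastCases ?_ (fun j => ?_) i
          · simp [← Finset.mul_sum]; ring
          · simp
        rw [h6]
        have h7 : ∑ i, (s • pExt (n+1) x) i = s := by
          rw [hpE, Fin.sum_univ_castSucc]
          simp [← Finset.mul_sum]; ring
        have h8 : s • pExt (n+1) x ∈ (Set.univ.pi fun _ : Fin (n+1) => Set.Ioi (0:ℝ))
            ↔ x ∈ Dset (n+1) := by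
          rw [hpE]
          simp only [Set.mem_pi, Set.mem_univ, true_imp_iff, Set.mem_Ioi, Pi.smul_apply,
            smul_eq_mul, mul_pos_iff_of_pos_left hs, Dset, Fin.forall_fin_succ']
          simp
        by_cases hx : x ∈ Dset (n+1)
        · rw [hg, Set.indicator_of_mem (h8.2 hx), Set.indicator_of_mem hx, h7, hf s hs]; ring
        · rw [hg, Set.indicator_of_notMem (fun h => hx (h8.1 h)), Set.indicator_of_notMem hx]
          simp
      simp only [h5] at h4
      rw [integral_const_mul] at h4
      have h9 : ∫ x : Fin n → ℝ, (Dset (n+1)).indicator (fun x => f (pExt (n+1) x)) x = J :=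
        integral_indicator hmD
      rw [h9] at h4
      have hsn : 0 < s ^ n := pow_pos hs n
      simp only [Module.finrank_fintype_fun_eq_card, Fintype.card_fin, smul_eq_mul,
        abs_of_pos (inv_pos.2 hsn)] at h4
      field_simp at h4
      rw [← h4, pow_add]; ring
    · rw [Set.indicator_of_notMem (by exact hs)]
      have : ∀ y : Fin n → ℝ, g (Fin.snoc (α := fun _ => ℝ) y (s - ∑ i, y i)) = 0 := by
        intro y
        rw [hg, Set.indicator_of_notMem]
        intro h
        apply hs
        simp only [Set.mem_pi, Set.mem_univ, true_imp_iff, Set.mem_Ioi] at h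
        have h10 := Finset.sum_pos (s := Finset.univ) (fun i _ => h i) ⟨Fin.last n, by simp⟩
        rw [Fin.sum_univ_castSucc] at h10
        simpa using h10
      simp [this]
  simp only [h3]
  rw [integral_indicator measurableSet_Ioi, integral_mul_const]
  congr 1
  have h11 := Real.Gamma_eq_integral (s := ((n + d : ℕ) : ℝ) + 1) (by positivity)
  rw [Real.Gamma_nat_eq_factorial] at h11
  rw [h11]
  simp only [add_sub_cancel_right, Real.rpow_natCast]

open MeasureTheory in
lemma integ_mono (β : ℝ) (hβ : -1 < β) (c : ℝ) (a b : ℕ) :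
    IntegrableOn (fun q => c * (Real.exp (-q) * q ^ β * q ^ a * q ^ b)) (Set.Ioi (0:ℝ)) := by
  apply Integrable.const_mul
  have h := Real.GammaIntegral_convergent (s := β + a + b + 1)
    (by have := Nat.cast_nonneg (α := ℝ) a; have := Nat.cast_nonneg (α := ℝ) b; linarith)
  refine h.congr_fun (fun q hq => ?_) measurableSet_Ioi
  have hq : 0 < q := hq
  simp only [add_sub_cancel_right]
  rw [Real.rpow_add hq, Real.rpow_add hq, Real.rpow_natCast, Real.rpow_natCast]; ring

lemma lag_expand (k l : ℕ) (β q : ℝ) :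
    Real.exp (-q) * q ^ β * laguerre k q * laguerre l q
    = ∑ a ∈ Finset.range (k+1), ∑ b ∈ Finset.range (l+1),
      (((-1) ^ a * (k.choose a : ℝ) / a.factorial) * ((-1) ^ b * (l.choose b : ℝ) / b.factorial)) *
        (Real.exp (-q) * q ^ β * q ^ a * q ^ b) := by
  simp only [laguerre]
  rw [mul_assoc (_ * _), Finset.sum_mul_sum, Finset.mul_sum]
  refine Finset.sum_congr rfl fun a _ => ?_
  rw [Finset.mul_sum]
  refine Finset.sum_congr rfl fun b _ => ?_
  ring

open MeasureTheory in
lemma lag_int (k l : ℕ) (β : ℝ) (hβ : -1 < β) :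
    IntegrableOn (fun q => Real.exp (-q) * q ^ β * laguerre k q * laguerre l q)
      (Set.Ioi (0:ℝ)) := by
  simp only [lag_expand]
  exact integrable_finsetSum _ fun a _ => integrable_finsetSum _ fun b _ =>
    integ_mono β hβ _ a b

lemma choose_alt (k m : ℕ) (h : m ≤ k) :
    ∑ j ∈ Finset.range (k+1), (-1:ℝ) ^ j * (k.choose j : ℝ) * ((m + j).choose m : ℝ)
      = if m = k then (-1) ^ k else 0 := by
  have h1 := fwdDiff_iter_eq_sum_shift (1:ℕ) (fun x ↦ x.choose m : ℕ → ℤ) k m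
  have h2 : (fwdDiff 1)^[k] (fun x ↦ x.choose m : ℕ → ℤ) m = if m = k then 1 else 0 := by
    rcases h.eq_or_lt with rfl | hlt
    · have := fwdDiff_iter_choose 0 m
      simp only [add_zero] at this
      rw [this]; simp
    · rcases Nat.exists_eq_add_of_lt hlt with ⟨r, rfl⟩
      have := fwdDiff_iter_choose 0 m
      simp only [add_zero] at this
      rw [if_neg hlt.ne, (by ring : m + r + 1 = r + 1 + m), Function.iterate_add_apply, this]
      simp only [Nat.choose_zero_right, Nat.cast_one]
      rw [Function.iterate_succ_apply, fwdDiff_const, fwdDiff_iter_eq_sum_shift]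
      simp
  rw [h2] at h1
  have h3 := congrArg (fun z : ℤ => (-1:ℝ) ^ k * (z : ℝ)) h1
  simp only [Int.cast_sum, Finset.mul_sum] at h3
  have h4 : (if m = k then (-1:ℝ) ^ k else 0) = (-1:ℝ) ^ k * ((if m = k then 1 else 0 : ℤ) : ℝ) := by
    split_ifs <;> simp
  rw [h4, h3]
  refine Finset.sum_congr rfl fun j hj => ?_
  have hj : j ≤ k := by simpa [Nat.lt_succ_iff] using hj
  obtain ⟨r, rfl⟩ := Nat.exists_eq_add_of_le hj
  simp only [add_tsub_cancel_left, smul_eq_mul, mul_one, Int.cast_mul, Int.cast_pow, Int.cast_neg,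
    Int.cast_one, Int.cast_natCast, pow_add]
  have : (-1:ℝ)^r * (-1)^r = 1 := by rw [← mul_pow]; simp
  linear_combination (-(-1:ℝ) ^ j * ((j+r).choose j : ℝ) * ((m + j).choose m : ℝ)) * this

open MeasureTheory in
lemma Ikl_zero_le (k l : ℕ) (hlk : l ≤ k) : Ikl k l 0 = if k = l then 1 else 0 := by
  unfold Ikl
  simp only [lag_expand]
  rw [integral_finsetSum _ fun a _ => integrable_finsetSum _ fun b _ =>
    integ_mono 0 (by norm_num) _ a b]
  have h1 : ∀ (c : ℝ) (a b : ℕ), ∫ q in Set.Ioi (0:ℝ),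
      c * (Real.exp (-q) * q ^ (0:ℝ) * q ^ a * q ^ b) = c * (b + a).factorial := by
    intro c a b
    rw [integral_const_mul]
    congr 1
    have h11 := Real.Gamma_eq_integral (s := ((b + a : ℕ) : ℝ) + 1) (by positivity)
    rw [Real.Gamma_nat_eq_factorial] at h11
    rw [h11]
    refine setIntegral_congr_fun measurableSet_Ioi fun q hq => ?_
    simp only [add_sub_cancel_right, Real.rpow_natCast, Real.rpow_zero]; ring
  have h2 : ∀ a, ∫ q in Set.Ioi (0:ℝ), ∑ b ∈ Finset.range (l+1),
      (((-1) ^ a * (k.choose a : ℝ) / a.factorial) * ((-1) ^ b * (l.choose b : ℝ) / b.factorial)) *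
        (Real.exp (-q) * q ^ (0:ℝ) * q ^ a * q ^ b) = ∑ b ∈ Finset.range (l+1),
      (((-1) ^ a * (k.choose a : ℝ) / a.factorial) * ((-1) ^ b * (l.choose b : ℝ) / b.factorial)) *
        (b + a).factorial := by
    intro a
    rw [integral_finsetSum _ fun b _ => integ_mono 0 (by norm_num) _ a b]
    simp only [h1]
  simp only [h2]
  rw [Finset.sum_comm]
  have h3 : ∀ b ∈ Finset.range (l+1), ∑ a ∈ Finset.range (k+1),
      (((-1) ^ a * (k.choose a : ℝ) / a.factorial) * ((-1) ^ b * (l.choose b : ℝ) / b.factorial)) *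
        ((b + a).factorial : ℝ) = (-1) ^ b * (l.choose b : ℝ) * if b = k then (-1) ^ k else 0 := by
    intro b hb
    have hb : b ≤ l := by simpa [Nat.lt_succ_iff] using hb
    rw [← choose_alt k b (hb.trans hlk), Finset.mul_sum]
    refine Finset.sum_congr rfl fun a _ => ?_
    have := Nat.add_choose_mul_factorial_mul_factorial b a
    rw [← this, Nat.choose_symm_add]
    push_cast
    field_simp
  rw [Finset.sum_congr rfl h3]
  by_cases h : k = l
  · subst h
    have : (-1:ℝ)^k * (-1)^k = 1 := by rw [← mul_pow]; simp
    simp [this]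
  · rw [if_neg h]
    refine Finset.sum_eq_zero fun b hb => ?_
    have hb : b ≤ l := by simpa [Nat.lt_succ_iff] using hb
    rw [if_neg (by omega), mul_zero]

lemma Ikl_zero (k l : ℕ) : Ikl k l 0 = if k = l then 1 else 0 := by
  rcases le_total l k with h | h
  · exact Ikl_zero_le k l h
  · have : Ikl k l 0 = Ikl l k 0 := by
      unfold Ikl; congr 1; ext q; ring
    rw [this, Ikl_zero_le l k h]; simp [eq_comm]

lemma vander_sq (μ : ℕ) (q : Fin μ → ℝ) :
    (∏ a, ∏ b ∈ Finset.Ioi a, (q a - q b) ^ 2)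
      = (∏ k ∈ Finset.range μ, ((k.factorial : ℝ)) ^ 2) *
        (Matrix.det (Matrix.of fun i k : Fin μ => laguerre k (q i))) ^ 2 := by
  have h1 : (∏ a, ∏ b ∈ Finset.Ioi a, (q a - q b) ^ 2) = (Matrix.vandermonde q).det ^ 2 := by
    rw [Matrix.det_vandermonde, ← Finset.prod_pow]
    refine Finset.prod_congr rfl fun a _ => ?_
    rw [← Finset.prod_pow]
    refine Finset.prod_congr rfl fun b _ => ?_
    ring
  let C : Matrix (Fin μ) (Fin μ) ℝ :=
    Matrix.of fun j k => (-1) ^ (j:ℕ) * ((k:ℕ).choose j : ℝ) / ((j:ℕ).factorial : ℝ)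
  have h2 : (Matrix.of fun i k : Fin μ => laguerre k (q i)) = Matrix.vandermonde q * C := by
    ext i k
    rw [Matrix.mul_apply]
    simp only [Matrix.of_apply, Matrix.vandermonde_apply, C, laguerre]
    rw [Fin.sum_univ_eq_sum_range (fun j => q i ^ j * ((-1) ^ j * ((k:ℕ).choose j : ℝ) / (j.factorial : ℝ))) μ]
    have hsub : Finset.range ((k:ℕ)+1) ⊆ Finset.range μ :=
      Finset.range_subset_range.2 k.2
    rw [← Finset.sum_subset hsub]
    · refine Finset.sum_congr rfl fun j _ => ?_
      ring
    · intro j _ hj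
      rw [Nat.choose_eq_zero_of_lt (by simpa using hj)]
      simp
  have h3 : C.det = ∏ j : Fin μ, (-1:ℝ) ^ (j:ℕ) / ((j:ℕ).factorial : ℝ) := by
    rw [Matrix.det_of_isUpperTriangular]
    · simp [C]
    · intro i j hij
      have hij : j < i := hij
      simp only [C, Matrix.of_apply]
      rw [Nat.choose_eq_zero_of_lt (by exact_mod_cast hij)]
      simp
  rw [h1, h2, Matrix.det_mul, h3, mul_pow, Finset.prod_range, ← Finset.prod_pow]
  have h4 : (∏ i : Fin μ, ((i:ℕ).factorial : ℝ) ^ 2) *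
      ∏ j : Fin μ, ((-1:ℝ) ^ (j:ℕ) / ((j:ℕ).factorial : ℝ)) ^ 2 = 1 := by
    rw [← Finset.prod_mul_distrib]
    refine Finset.prod_eq_one fun j _ => ?_
    rw [div_pow, ← pow_mul, mul_comm (j:ℕ) 2, pow_mul]
    field_simp; simp
  linear_combination -(Matrix.vandermonde q).det ^ 2 * h4

lemma det_minor {ι κ : Type*} [Fintype ι] [DecidableEq ι] [Fintype κ] [DecidableEq κ]
    (A : Matrix ι ι ℝ) (u : κ → ι) (hu : Function.Injective u) :
    (Matrix.of fun a b => if a ∈ Finset.univ.image u then A a b else if a = b then 1 else 0).det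
      = (A.submatrix u u).det := by
  let U : Matrix ι κ ℝ := Matrix.of fun a j => if a = u j then 1 else 0
  let V : Matrix κ ι ℝ := Matrix.of fun j b => A (u j) b - if u j = b then 1 else 0
  have h1 : (Matrix.of fun a b => if a ∈ Finset.univ.image u then A a b
      else if a = b then (1:ℝ) else 0) = 1 + U * V := by
    ext a b
    rw [Matrix.add_apply, Matrix.mul_apply]
    simp only [Matrix.of_apply, U, V, Matrix.one_apply]
    by_cases h : a ∈ Finset.univ.image u
    · rw [if_pos h]
      obtain ⟨j, _, rfl⟩ := Finset.mem_image.1 h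
      simp [hu.eq_iff]
    · rw [if_neg h]
      have : ∀ j, a ≠ u j := fun j hj => h (by simp [hj])
      simp [this]
  have h2 : A.submatrix u u = 1 + V * U := by
    ext i j
    rw [Matrix.add_apply, Matrix.mul_apply]
    simp [U, V, Matrix.one_apply, hu.eq_iff]
  rw [h1, h2, Matrix.det_one_add_mul_comm]

noncomputable def Imat (μ : ℕ) : Matrix (Fin μ) (Fin μ) ℝ := Matrix.of fun a b => Ikl a b (1/2)

lemma integrand_expand (μ : ℕ) (u : Fin 4 → Fin μ) (hu : Function.Injective u) (q : Fin μ → ℝ) :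
    Real.exp (-∑ i, q i) * ((∏ j, Real.sqrt (q (u j))) *
        (Matrix.det (Matrix.of fun i k : Fin μ => laguerre k (q i))) ^ 2)
    = ∑ σ : Equiv.Perm (Fin μ), ∑ τ : Equiv.Perm (Fin μ),
      (((Equiv.Perm.sign σ : ℤ) : ℝ) * ((Equiv.Perm.sign τ : ℤ) : ℝ)) *
      ∏ i, (Real.exp (-(q i)) * (q i) ^ (if i ∈ Finset.univ.image u then (1/2:ℝ) else 0)
        * laguerre (σ i) (q i) * laguerre (τ i) (q i)) := by
  have h1 : ∏ i, (q i) ^ (if i ∈ Finset.univ.image u then (1/2:ℝ) else 0)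
      = ∏ j, Real.sqrt (q (u j)) := by
    rw [← Finset.prod_image (s := Finset.univ) (g := u) (f := fun i => Real.sqrt (q i))
      (fun a _ b _ h => hu h)]
    rw [← Finset.prod_subset (Finset.subset_univ (Finset.univ.image u))]
    · refine Finset.prod_congr rfl fun i hi => ?_
      rw [if_pos hi, Real.sqrt_eq_rpow]
    · intro i _ hi
      rw [if_neg hi, Real.rpow_zero]
  rw [← Matrix.det_transpose, sq, Matrix.det_apply', Finset.sum_mul_sum, Finset.mul_sum,
    Finset.mul_sum]
  refine Finset.sum_congr rfl fun σ _ => ?_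
  rw [Finset.mul_sum, Finset.mul_sum]
  refine Finset.sum_congr rfl fun τ _ => ?_
  simp only [Finset.prod_mul_distrib, h1, ← Real.exp_sum, Finset.sum_neg_distrib,
    Matrix.transpose_apply, Matrix.of_apply]
  ring

open MeasureTheory in
lemma term_integrable (μ : ℕ) (u : Fin 4 → Fin μ) (c : ℝ) (σ τ : Equiv.Perm (Fin μ)) :
    IntegrableOn (fun q : Fin μ → ℝ => c * 
      ∏ i, (Real.exp (-(q i)) * (q i) ^ (if i ∈ Finset.univ.image u then (1/2:ℝ) else 0)
        * laguerre (σ i) (q i) * laguerre (τ i) (q i))) (Set.univ.pi fun _ => Set.Ioi (0:ℝ)) := by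
  rw [IntegrableOn, volume_pi, Measure.restrict_pi_pi]
  refine (Integrable.fintype_prod (f := fun (i : Fin μ) (x : ℝ) => 
      Real.exp (-x) * x ^ (if i ∈ Finset.univ.image u then (1/2:ℝ) else 0)
        * laguerre (σ i) x * laguerre (τ i) x) fun i => ?_).const_mul c
  exact lag_int _ _ _ (by split_ifs <;> norm_num)

open MeasureTheory in
lemma integrand_integrable (μ : ℕ) (u : Fin 4 → Fin μ) (hu : Function.Injective u) :
    IntegrableOn (fun q : Fin μ → ℝ => Real.exp (-∑ i, q i) * ((∏ j, Real.sqrt (q (u j))) *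
        (Matrix.det (Matrix.of fun i k : Fin μ => laguerre k (q i))) ^ 2))
        (Set.univ.pi fun _ => Set.Ioi (0:ℝ)) := by
  simp only [integrand_expand μ u hu]
  exact integrable_finsetSum _ fun σ _ => integrable_finsetSum _ fun τ _ =>
    term_integrable μ u _ σ τ

open MeasureTheory in
lemma integrand_integral (μ : ℕ) (u : Fin 4 → Fin μ) (hu : Function.Injective u) :
    ∫ q in (Set.univ.pi fun _ => Set.Ioi (0:ℝ)), Real.exp (-∑ i, q i) *
      ((∏ j, Real.sqrt (q (u j))) *
        (Matrix.det (Matrix.of fun i k : Fin μ => laguerre k (q i))) ^ 2)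
    = ∑ σ : Equiv.Perm (Fin μ), ((Imat μ).submatrix (σ ∘ u) (σ ∘ u)).det := by
  simp only [integrand_expand μ u hu]
  rw [integral_finsetSum _ fun σ _ => integrable_finsetSum _ fun τ _ =>
    term_integrable μ u _ σ τ]
  refine Finset.sum_congr rfl fun σ _ => ?_
  rw [integral_finsetSum _ fun τ _ => term_integrable μ u _ σ τ]
  rw [← det_minor _ _ (σ.injective.comp hu)]
  set N : Matrix (Fin μ) (Fin μ) ℝ := (Matrix.of fun a b =>
    if a ∈ Finset.univ.image (σ ∘ u) then Imat μ a b else if a = b then 1 else 0) with hN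
  have h1 := Matrix.det_permute σ N
  have h2 : (((Equiv.Perm.sign σ : ℤ) : ℝ)) * ((Equiv.Perm.sign σ : ℤ) : ℝ) = 1 := by
    rcases Int.units_eq_one_or (Equiv.Perm.sign σ) with h | h <;> simp [h]
  have h3 : N.det = ((Equiv.Perm.sign σ : ℤ) : ℝ) * (N.submatrix σ id).det := by
    rw [h1, ← mul_assoc, h2, one_mul]
  rw [h3, ← Matrix.det_transpose, Matrix.det_apply', Finset.mul_sum]
  refine Finset.sum_congr rfl fun τ _ => ?_
  rw [integral_const_mul, mul_assoc]
  congr 2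
  rw [volume_pi, Measure.restrict_pi_pi]
  rw [integral_fintype_prod_eq_prod (f := fun (i : Fin μ) (x : ℝ) => 
      Real.exp (-x) * x ^ (if i ∈ Finset.univ.image u then (1/2:ℝ) else 0)
        * laguerre (σ i) x * laguerre (τ i) x)]
  refine Finset.prod_congr rfl fun i _ => ?_
  have h4 : σ i ∈ Finset.univ.image (σ ∘ u) ↔ i ∈ Finset.univ.image u := by
    simp
  simp only [Matrix.transpose_apply, Matrix.submatrix_apply, hN, Matrix.of_apply, id, h4]
  by_cases hi : i ∈ Finset.univ.image u
  · simp only [if_pos hi]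
    rfl
  · simp only [if_neg hi]
    have := Ikl_zero (σ i) (τ i)
    simp only [Fin.val_inj] at this
    rw [← this]
    rfl

def tup {μ : ℕ} (t : Fin μ × Fin μ × Fin μ × Fin μ) : Fin 4 → Fin μ :=
  ![t.1, t.2.1, t.2.2.1, t.2.2.2]

lemma tup_inj {μ : ℕ} (t : Fin μ × Fin μ × Fin μ × Fin μ) :
    Function.Injective (tup t) ↔ (t.1 ≠ t.2.1 ∧ t.1 ≠ t.2.2.1 ∧ t.1 ≠ t.2.2.2 ∧
              t.2.1 ≠ t.2.2.1 ∧ t.2.1 ≠ t.2.2.2 ∧ t.2.2.1 ≠ t.2.2.2) := by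
  constructor
  · intro h
    refine ⟨h.ne (a₁ := 0) (a₂ := 1) (by decide), h.ne (a₁ := 0) (a₂ := 2) (by decide),
      h.ne (a₁ := 0) (a₂ := 3) (by decide), h.ne (a₁ := 1) (a₂ := 2) (by decide),
      h.ne (a₁ := 1) (a₂ := 3) (by decide), h.ne (a₁ := 2) (a₂ := 3) (by decide)⟩
  · rintro ⟨h1, h2, h3, h4, h5, h6⟩ a b
    fin_cases a <;> fin_cases b <;> simp [tup, *, Ne.symm]

lemma minor_zero {μ : ℕ} (A : Matrix (Fin μ) (Fin μ) ℝ) (u : Fin 4 → Fin μ)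
    (hu : ¬ Function.Injective u) : (A.submatrix u u).det = 0 := by
  simp only [Function.Injective, not_forall] at hu
  obtain ⟨a, b, hab, hne⟩ := hu
  exact Matrix.det_zero_of_row_eq hne (by ext j; simp [hab])

lemma sum_minors (μ : ℕ) (A : Matrix (Fin μ) (Fin μ) ℝ) :
    ∑ t ∈ Finset.univ.filter
            (fun t : Fin μ × Fin μ × Fin μ × Fin μ =>
              t.1 ≠ t.2.1 ∧ t.1 ≠ t.2.2.1 ∧ t.1 ≠ t.2.2.2 ∧
              t.2.1 ≠ t.2.2.1 ∧ t.2.1 ≠ t.2.2.2 ∧ t.2.2.1 ≠ t.2.2.2),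
      ∑ σ : Equiv.Perm (Fin μ), (A.submatrix (σ ∘ tup t) (σ ∘ tup t)).det
    = (μ.factorial : ℝ) * ∑ t : Fin μ × Fin μ × Fin μ × Fin μ,
        (A.submatrix (tup t) (tup t)).det := by
  rw [Finset.sum_filter_of_ne, Finset.sum_comm]
  · have : ∀ σ : Equiv.Perm (Fin μ),
        ∑ t : Fin μ × Fin μ × Fin μ × Fin μ, (A.submatrix (σ ∘ tup t) (σ ∘ tup t)).det
        = ∑ t : Fin μ × Fin μ × Fin μ × Fin μ, (A.submatrix (tup t) (tup t)).det := by
      intro σ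
      rw [← Equiv.sum_comp (σ.prodCongr (σ.prodCongr (σ.prodCongr σ)))
        (fun t => (A.submatrix (tup t) (tup t)).det)]
      refine Finset.sum_congr rfl fun t _ => ?_
      have : tup ((σ.prodCongr (σ.prodCongr (σ.prodCongr σ))) t) = σ ∘ tup t := by
        ext j; fin_cases j <;> rfl
      rw [this]
    simp only [this]
    simp [Fintype.card_perm]
  · intro t _ h
    rw [← tup_inj]
    by_contra hn
    apply h
    refine Finset.sum_eq_zero fun σ _ => minor_zero A _ fun h => hn ?_
    exact h.of_comp

open MeasureTheory in
theorem fourth_moment_formula (μ : ℕ) (hμ : 1 ≤ μ) :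
    (Real.Gamma ((μ : ℝ) ^ 2) / Qbar μ) *
      ∫ x in Dset μ,
        (∑ t ∈ Finset.univ.filter
            (fun t : Fin μ × Fin μ × Fin μ × Fin μ =>
              t.1 ≠ t.2.1 ∧ t.1 ≠ t.2.2.1 ∧ t.1 ≠ t.2.2.2 ∧
              t.2.1 ≠ t.2.2.1 ∧ t.2.1 ≠ t.2.2.2 ∧ t.2.2.1 ≠ t.2.2.2),
            Real.sqrt (pExt μ x t.1 * pExt μ x t.2.1 * pExt μ x t.2.2.1 * pExt μ x t.2.2.2)) *
          (∏ a, ∏ b ∈ Finset.Ioi a, (pExt μ x a - pExt μ x b) ^ 2)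
      = (1 / ((μ : ℝ) ^ 2 * ((μ : ℝ) ^ 2 + 1))) *
        ∑ k ∈ Finset.range μ, ∑ l ∈ Finset.range μ,
          ∑ m ∈ Finset.range μ, ∑ n ∈ Finset.range μ,
            Matrix.det (Matrix.of fun r c : Fin 4 =>
              Ikl (![k, l, m, n] r) (![k, l, m, n] c) (1/2)) := by
  obtain ⟨n, rfl⟩ : ∃ n, μ = n + 1 := ⟨μ - 1, by omega⟩
  set T := Finset.univ.filter
            (fun t : Fin (n+1) × Fin (n+1) × Fin (n+1) × Fin (n+1) =>
              t.1 ≠ t.2.1 ∧ t.1 ≠ t.2.2.1 ∧ t.1 ≠ t.2.2.2 ∧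
              t.2.1 ≠ t.2.2.1 ∧ t.2.1 ≠ t.2.2.2 ∧ t.2.2.1 ≠ t.2.2.2) with hT
  let f : (Fin (n+1) → ℝ) → ℝ := fun p =>
    (∑ t ∈ T, Real.sqrt (p t.1 * p t.2.1 * p t.2.2.1 * p t.2.2.2)) *
          (∏ a, ∏ b ∈ Finset.Ioi a, (p a - p b) ^ 2)
  set P := ∏ k ∈ Finset.range (n+1), ((k.factorial : ℝ)) ^ 2 with hP
  have hPpos : 0 < P := Finset.prod_pos fun k _ => by positivity
  have hS : MeasurableSet (Set.univ.pi fun _ : Fin (n+1) => Set.Ioi (0:ℝ)) :=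
    MeasurableSet.univ_pi fun _ => measurableSet_Ioi
  have hf : ∀ s : ℝ, 0 < s → ∀ p, f (s • p) = s ^ (2 + (n+1) * n) * f p := by
    intro s hs p
    have h1 : ∀ t : Fin (n+1) × Fin (n+1) × Fin (n+1) × Fin (n+1),
        Real.sqrt ((s • p) t.1 * (s • p) t.2.1 * (s • p) t.2.2.1 * (s • p) t.2.2.2)
        = s ^ 2 * Real.sqrt (p t.1 * p t.2.1 * p t.2.2.1 * p t.2.2.2) := by
      intro t
      have : (s • p) t.1 * (s • p) t.2.1 * (s • p) t.2.2.1 * (s • p) t.2.2.2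
        = (s ^ 2) ^ 2 * (p t.1 * p t.2.1 * p t.2.2.1 * p t.2.2.2) := by
        simp only [Pi.smul_apply, smul_eq_mul]; ring
      rw [this, Real.sqrt_mul (by positivity), Real.sqrt_sq (by positivity)]
    have h2 : (∏ a, ∏ b ∈ Finset.Ioi a, ((s • p) a - (s • p) b) ^ 2)
        = s ^ ((n+1) * n) * (∏ a, ∏ b ∈ Finset.Ioi a, (p a - p b) ^ 2) := by
      have h3 : ∀ a b, ((s • p) a - (s • p) b) ^ 2 = s ^ 2 * (p a - p b) ^ 2 := by
        intro a b; simp only [Pi.smul_apply, smul_eq_mul]; ring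
      simp only [h3, Finset.prod_mul_distrib, Finset.prod_const, Fin.card_Ioi,
        Finset.prod_pow_eq_pow_sum]
      congr 1
      rw [← pow_mul]
      congr 1
      rw [Fin.sum_univ_eq_sum_range (fun a => n + 1 - 1 - a) (n+1),
        Finset.sum_range_reflect (fun a => a) (n+1), mul_comm, Finset.sum_range_id_mul_two]
      simp
    simp only [f]
    rw [h2, pow_add]
    simp only [h1, ← Finset.mul_sum]
    ring
  have hfe : ∀ q ∈ (Set.univ.pi fun _ : Fin (n+1) => Set.Ioi (0:ℝ)),
      Real.exp (-∑ i, q i) * f q = P * ∑ t ∈ T, (Real.exp (-∑ i, q i) *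
        ((∏ j, Real.sqrt (q (tup t j))) *
        (Matrix.det (Matrix.of fun i k : Fin (n+1) => laguerre k (q i))) ^ 2)) := by
    intro q hq
    have hq : ∀ i, 0 < q i := fun i => hq i (Set.mem_univ i)
    simp only [f]
    rw [vander_sq, ← Finset.mul_sum, ← Finset.sum_mul]
    have h1 : ∀ t : Fin (n+1) × Fin (n+1) × Fin (n+1) × Fin (n+1),
        Real.sqrt (q t.1 * q t.2.1 * q t.2.2.1 * q t.2.2.2) = ∏ j, Real.sqrt (q (tup t j)) := by
      intro t
      have := (hq t.1).le
      have := (hq t.2.1).le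
      have := (hq t.2.2.1).le
      have := (hq t.2.2.2).le
      rw [Real.sqrt_mul (by positivity), Real.sqrt_mul (by positivity),
        Real.sqrt_mul (by positivity), Fin.prod_univ_four]
      rfl
    simp only [h1]
    ring
  have hTi : ∀ t ∈ T, Function.Injective (tup t) := fun t ht =>
    (tup_inj t).2 (Finset.mem_filter.1 ht).2
  have hint : IntegrableOn (fun q => Real.exp (-∑ i, q i) * f q)
      (Set.univ.pi fun _ => Set.Ioi (0:ℝ)) := by
    refine IntegrableOn.congr_fun ?_ (fun q hq => (hfe q hq).symm) hS
    exact (integrable_finsetSum _ fun t ht => integrand_integrable _ _ (hTi t ht)).const_mul P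
  have hrad := radial_aux n f _ hf hint
  rw [setIntegral_congr_fun hS hfe, integral_const_mul,
    integral_finsetSum _ fun t ht => integrand_integrable _ _ (hTi t ht),
    Finset.sum_congr rfl fun t ht => integrand_integral _ _ (hTi t ht), hT, sum_minors] at hrad
  have hsum : ∑ k ∈ Finset.range (n+1), ∑ l ∈ Finset.range (n+1),
          ∑ m ∈ Finset.range (n+1), ∑ r ∈ Finset.range (n+1),
            Matrix.det (Matrix.of fun i c : Fin 4 =>
              Ikl (![k, l, m, r] i) (![k, l, m, r] c) (1/2))
      = ∑ t, ((Imat (n+1)).submatrix (tup t) (tup t)).det := by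
    simp only [Finset.sum_range, Fintype.sum_prod_type]
    refine Finset.sum_congr rfl fun k _ => Finset.sum_congr rfl fun l _ =>
      Finset.sum_congr rfl fun m _ => Finset.sum_congr rfl fun r _ => ?_
    congr 1
    ext i j
    fin_cases i <;> fin_cases j <;> rfl
  rw [hsum]
  change (Real.Gamma (((n+1 : ℕ) : ℝ) ^ 2) / Qbar (n+1)) *
    (∫ x in Dset (n+1), f (pExt (n+1) x)) = _
  set J := ∫ x in Dset (n+1), f (pExt (n+1) x)
  set R := ∑ t, ((Imat (n+1)).submatrix (tup t) (tup t)).det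
  have hG : Real.Gamma (((n+1 : ℕ) : ℝ) ^ 2) = ((n * (n + 2)).factorial : ℝ) := by
    rw [← Real.Gamma_nat_eq_factorial]; congr 1; push_cast; ring
  have hF : ((n + (2 + (n+1) * n)).factorial : ℝ) = (((n+1 : ℕ) : ℝ) ^ 2 + 1) *
      (((n+1 : ℕ) : ℝ) ^ 2) * ((n * (n + 2)).factorial : ℝ) := by
    have : n + (2 + (n+1) * n) = n * (n+2) + 1 + 1 := by ring
    rw [this, Nat.factorial_succ, Nat.factorial_succ]; push_cast; ring
  rw [hF] at hrad
  rw [hG, Qbar, ← hP]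
  have hne : (((n+1 : ℕ) : ℝ)) ^ 2 ≠ 0 := by positivity
  have hne2 : (((n+1 : ℕ) : ℝ)) ^ 2 + 1 ≠ 0 := by positivity
  have hne3 : ((n+1).factorial : ℝ) ≠ 0 := by positivity
  rw [div_mul_eq_mul_div, div_mul_eq_mul_div, div_eq_div_iff (by positivity) (by positivity)]
  linear_combination -hrad
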